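/- arXiv:2312.02749 — 4 statements merged into one kernel-verified Lean document; each statement's English description precedes it below -/
import Mathlib

section
/- Let N and L be nonnegative integers and let μ be a partition with μ₁ ≤ N and μᵗ₁ ≤ L. Then the generating function of skew plane partitions of shape (N×L)∖μᵗ satisfies Z_{N,L,μ} · ∏_{1≤n≤N, 1≤l≤L} (1 − q^{n+l−1}) · ∏_{(i,j)∈μ} (1 − q^{h(i,j)}) = ∏_{(i,j)∈μ} (1 − q^{N−c(i,j)})(1 − q^{L+c(i,j)}) in ℤ[[q]]; equivalently Z_{N,L,μ} = ∏_{1≤n≤N,1≤l≤L}(1−q^{n+l−1})^{−1} · ∏_{(i,j)∈μ} (1−q^{N−c(i,j)})(1−q^{L+c(i,j)})/(1−q^{h(i,j)}). -/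
open Finset PowerSeries

noncomputable section

/-- Parts of a partition, 0-indexed: `μ i` is the `(i+1)`-st part `μ_{i+1}`. -/
def IsPartition (μ : ℕ → ℕ) : Prop := Antitone μ ∧ ∃ n, μ n = 0

/-- Conjugate partition, 0-indexed: `conj μ j = μᵗ_{j+1} = #{i : μ_i ≥ j+1}`. -/
def conj (μ : ℕ → ℕ) (j : ℕ) : ℕ := Set.ncard {i | j + 1 ≤ μ i}

/-- Cells of the Young diagram of `μ`, 0-indexed: `(i, j)` is the cell in row `i+1`,
column `j+1`. -/
def cells (μ : ℕ → ℕ) : Finset (ℕ × ℕ) :=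
  (range (conj μ 0) ×ˢ range (μ 0)).filter fun p => p.2 < μ p.1

/-- Hook length of the (0-indexed) cell `p` of `μ`:
`h(i+1, j+1) = μ_{i+1} + μᵗ_{j+1} - (i+1) - (j+1) + 1`. -/
def hook (μ : ℕ → ℕ) (p : ℕ × ℕ) : ℕ := μ p.1 + conj μ p.2 - (p.1 + p.2 + 1)

/-- The (0-indexed) cell `(i, j)` lies in the skew shape `(N×L) ∖ μᵗ`, i.e. (1-indexed)
`1 ≤ i ≤ N`, `1 ≤ j ≤ L`, `j > μᵗ_i`; here `μt i = μᵗ_{i+1}`. -/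
def InShape (N L : ℕ) (μt : ℕ → ℕ) (i j : ℕ) : Prop := i < N ∧ μt i ≤ j ∧ j < L

/-- A skew plane partition of shape `(N×L) ∖ μᵗ`: nonnegative entries on the cells of the
shape (zero outside), weakly decreasing along rows and columns within the shape. -/
def IsSkewPP (N L : ℕ) (μt : ℕ → ℕ) (π : ℕ → ℕ → ℕ) : Prop :=
  (∀ i j, ¬ InShape N L μt i j → π i j = 0) ∧
  (∀ i j, InShape N L μt i j → InShape N L μt i (j + 1) → π i (j + 1) ≤ π i j) ∧
  (∀ i j, InShape N L μt i j → InShape N L μt (i + 1) j → π (i + 1) j ≤ π i j)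

/-- The size of a plane partition supported in the `N × L` rectangle. -/
def ppSize (N L : ℕ) (π : ℕ → ℕ → ℕ) : ℕ := ∑ i ∈ range N, ∑ j ∈ range L, π i j

/-- `Z N L μ ∈ ℤ[[q]]`: the generating function `Σ_π q^{|π|}` over skew plane partitions of
shape `(N×L) ∖ μᵗ`. -/
def Z (N L : ℕ) (μ : ℕ → ℕ) : PowerSeries ℤ :=
  PowerSeries.mk fun n =>
    (Nat.card {π : ℕ → ℕ → ℕ // IsSkewPP N L (conj μ) π ∧ ppSize N L π = n} : ℤ)

def HasGF {α : Type} (w : α → ℤ) (P : PowerSeries ℤ) : Prop :=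
  (∀ a, 0 ≤ w a) ∧ ∀ n : ℕ, Finite {a // w a = n} ∧
    (Nat.card {a // w a = (n : ℤ)} : ℤ) = PowerSeries.coeff n P

lemma HasGF.congr {α β : Type} {w : α → ℤ} {v : β → ℤ} {P : PowerSeries ℤ}
    (e : α ≃ β) (h : ∀ a, w a = v (e a)) (hv : HasGF v P) : HasGF w P := by
  have E : ∀ n : ℕ, {a // w a = (n:ℤ)} ≃ {b // v b = (n:ℤ)} := fun n =>
    e.subtypeEquiv (fun a => by rw [h])
  refine ⟨fun a => by rw [h]; exact hv.1 _, fun n => ⟨?_, ?_⟩⟩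
  · have := (hv.2 n).1
    exact Finite.of_equiv _ (E n).symm
  · rw [Nat.card_congr (E n)]; exact (hv.2 n).2

lemma HasGF.step {A : Type} {w : A → ℤ} {P Q : PowerSeries ℤ} (h : ℕ) (hh : 0 < h)
    (hw : HasGF w P) (hQ : Q * (1 - X ^ h) = P) :
    HasGF (fun p : ℕ × A => (h : ℤ) * p.1 + w p.2) Q := by
  refine ⟨fun p => by have := hw.1 p.2; positivity, ?_⟩
  intro n
  induction n using Nat.strong_induction_on with
  | _ n ih =>
  obtain ⟨f1, c1⟩ := hw.2 n
  have hc : PowerSeries.coeff n Q = PowerSeries.coeff n P +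
      if h ≤ n then PowerSeries.coeff (n - h) Q else 0 := by
    rw [← hQ, mul_sub, mul_one, map_sub, PowerSeries.coeff_mul_X_pow']; ring
  by_cases hn : h ≤ n
  · obtain ⟨f2, c2⟩ := ih (n - h) (by omega)
    let E : {p : ℕ × A // (h : ℤ) * p.1 + w p.2 = (n:ℤ)} ≃
        {a // w a = (n:ℤ)} ⊕ {p : ℕ × A // (h : ℤ) * p.1 + w p.2 = ((n-h : ℕ):ℤ)} :=
      { toFun := fun p => match p with
          | ⟨(0, a), q⟩ => Sum.inl ⟨a, by simpa using q⟩
          | ⟨(k+1, a), q⟩ => Sum.inr ⟨(k, a), by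
              push_cast [hn] at q ⊢; linarith⟩
        invFun := fun s => match s with
          | Sum.inl a => ⟨(0, a.1), by simpa using a.2⟩
          | Sum.inr p => ⟨(p.1.1+1, p.1.2), by
              have := p.2; push_cast [hn] at this ⊢; linarith⟩
        left_inv := by rintro ⟨⟨_ | k, a⟩, q⟩ <;> rfl
        right_inv := by rintro (a | p) <;> rfl }
    refine ⟨Finite.of_equiv _ E.symm, ?_⟩
    rw [Nat.card_congr E, Nat.card_sum, hc, if_pos hn]
    push_cast
    rw [c1, c2]
  · let E : {p : ℕ × A // (h : ℤ) * p.1 + w p.2 = (n:ℤ)} ≃ {a // w a = (n:ℤ)} :=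
      { toFun := fun p => ⟨p.1.2, by
          obtain ⟨⟨k, a⟩, q⟩ := p
          rcases k with _ | k
          · simpa using q
          · exfalso
            have := hw.1 a
            push_cast at q
            have : (0:ℤ) ≤ h * k := by positivity
            have : (n:ℤ) < h := by exact_mod_cast (not_le.1 hn)
            linarith⟩
        invFun := fun a => ⟨(0, a.1), by simpa using a.2⟩
        left_inv := by
          rintro ⟨⟨k, a⟩, q⟩
          rcases k with _ | k
          · rfl
          · exfalso
            have := hw.1 a
            push_cast at q
            have : (0:ℤ) ≤ h * k := by positivity
            have : (n:ℤ) < h := by exact_mod_cast (not_le.1 hn)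
            linarith
        right_inv := by rintro a; rfl }
    refine ⟨Finite.of_equiv _ E.symm, ?_⟩
    rw [Nat.card_congr E, hc, if_neg hn, c1, add_zero]

def tog (a b : ℕ) (π : ℕ → ℕ → ℕ) (i j : ℕ) : ℕ :=
  if a < i ∧ i + b = j + a then
    min (π (i-1) j) (π i (j-1)) + max (π (i+1) j) (π i (j+1)) - π i j else π i j

def fwd (a b : ℕ) (π : ℕ → ℕ → ℕ) (i j : ℕ) : ℕ := if i = a ∧ j = b then 0 else tog a b π i j

def bwd (a b k : ℕ) (π : ℕ → ℕ → ℕ) (i j : ℕ) : ℕ :=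
  if i = a ∧ j = b then k + max (π (a+1) b) (π a (b+1)) else tog a b π i j

/-- corner hypotheses -/
def Corner (N L : ℕ) (ν : ℕ → ℕ) (a b : ℕ) : Prop :=
  a < N ∧ b < L ∧ ν a = b ∧ (∀ i, i < a → b < ν i) ∧ (∀ i, a < i → ν i ≤ b)

lemma bounds0 {N L : ℕ} {ν : ℕ → ℕ} {π : ℕ → ℕ → ℕ} {a b : ℕ} (hν' : ∀ i j, a < i → i + b = j + a → i < N → j < L → InShape N L ν i j ∧ InShape N L ν (i-1) j ∧ InShape N L ν i (j-1)) (h : IsSkewPP N L ν π) (i j : ℕ)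
    (hi : a < i) (hj : i + b = j + a) (h1 : i < N) (h2 : j < L) :
    max (π (i+1) j) (π i (j+1)) ≤ π i j ∧ π i j ≤ min (π (i-1) j) (π i (j-1)) := by
  obtain ⟨s1, s2, s3⟩ := hν' i j hi hj h1 h2
  obtain ⟨z, r, c⟩ := h
  refine ⟨max_le ?_ ?_, le_min ?_ ?_⟩
  · by_cases q : InShape N L ν (i+1) j
    · exact c _ _ s1 q
    · simp [z _ _ q]
  · by_cases q : InShape N L ν i (j+1)
    · exact r _ _ s1 q
    · simp [z _ _ q]
  · have := c (i-1) j s2 (by rwa [Nat.sub_add_cancel (by omega)])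
    rwa [Nat.sub_add_cancel (by omega)] at this
  · have := r i (j-1) s3 (by rwa [Nat.sub_add_cancel (by omega)])
    rwa [Nat.sub_add_cancel (by omega)] at this

lemma corner_shape {N L : ℕ} {ν} {a b : ℕ} (hc : Corner N L ν a b) (i j : ℕ) (hi : a < i) (hj : i + b = j + a) (h1 : i < N) (h2 : j < L) :
    InShape N L ν i j ∧ InShape N L ν (i-1) j ∧ InShape N L ν i (j-1) := by
  obtain ⟨c1, c2, c3, c4, c5⟩ := hc
  have e1 := c5 i hi
  have e2 : ν (i-1) ≤ b := by
    rcases (show a ≤ i-1 by omega).eq_or_lt with q | q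
    · rw [← q, c3]
    · exact c5 _ q
  unfold InShape
  omega

lemma shape_upd {N L : ℕ} {ν} {a b : ℕ} (hc : Corner N L ν a b) (i j : ℕ) :
    InShape N L (Function.update ν a (b+1)) i j ↔ InShape N L ν i j ∧ ¬ (i = a ∧ j = b) := by
  obtain ⟨c1, c2, c3, c4, c5⟩ := hc
  unfold InShape
  by_cases h : i = a
  · subst h; simp; omega
  · simp [h]

lemma corner_shape' {N L : ℕ} {ν} {a b : ℕ} (hc : Corner N L ν a b) (i j : ℕ) (hi : a < i) (hj : i + b = j + a) (h1 : i < N) (h2 : j < L) :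
    InShape N L (Function.update ν a (b+1)) i j ∧ InShape N L (Function.update ν a (b+1)) (i-1) j ∧ InShape N L (Function.update ν a (b+1)) i (j-1) := by
  simp only [shape_upd hc]
  obtain ⟨s1, s2, s3⟩ := corner_shape hc i j hi hj h1 h2
  refine ⟨⟨s1, by omega⟩, ⟨s2, by omega⟩, ⟨s3, by omega⟩⟩

/-- toggled cells outside the rectangle -/
lemma tog_zero {N L : ℕ} {ν : ℕ → ℕ} {π : ℕ → ℕ → ℕ} {a b : ℕ} (hπ : ∀ i j, ¬ InShape N L ν i j → π i j = 0)
   (i j : ℕ) (hi : a < i) (hj : i + b = j + a) (h : N ≤ i ∨ L ≤ j) :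
    min (π (i-1) j) (π i (j-1)) = 0 ∧ max (π (i+1) j) (π i (j+1)) = 0 ∧ π i j = 0 := by
  have h1 : π (i+1) j = 0 := hπ _ _ (by unfold InShape; omega)
  have h2 : π i (j+1) = 0 := hπ _ _ (by unfold InShape; omega)
  have h3 : π i j = 0 := hπ _ _ (by unfold InShape; omega)
  rcases h with h | h
  · have h4 : π i (j-1) = 0 := hπ _ _ (by unfold InShape; omega)
    simp [*]
  · have h4 : π (i-1) j = 0 := hπ _ _ (by unfold InShape; omega)
    simp [*]

lemma tog_ndiag {a b : ℕ} {π} {i j : ℕ} (h : ¬ (a < i ∧ i + b = j + a)) : tog a b π i j = π i j := by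
  simp [tog, h]

/-- general facts about toggles: all we need. -/
lemma tog_bounds {N L : ℕ} {ν : ℕ → ℕ} {π : ℕ → ℕ → ℕ} {a b : ℕ}
    (hb : ∀ i j, a < i → i + b = j + a → i < N → j < L → 
      max (π (i+1) j) (π i (j+1)) ≤ π i j ∧ π i j ≤ min (π (i-1) j) (π i (j-1)))
    (hπ : ∀ i j, ¬ InShape N L ν i j → π i j = 0)
    (i j : ℕ) (hi : a < i) (hj : i + b = j + a) :
    max (π (i+1) j) (π i (j+1)) ≤ tog a b π i j ∧ tog a b π i j ≤ min (π (i-1) j) (π i (j-1)) ∧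
    tog a b π i j + π i j = min (π (i-1) j) (π i (j-1)) + max (π (i+1) j) (π i (j+1)) := by
  have : tog a b π i j = min (π (i-1) j) (π i (j-1)) + max (π (i+1) j) (π i (j+1)) - π i j := by
    simp [tog, hi, hj]
  by_cases q : N ≤ i ∨ L ≤ j
  · obtain ⟨x, y, z⟩ := tog_zero hπ i j hi hj q
    omega
  · have := hb i j hi hj (by omega) (by omega)
    omega

lemma fwd_ok {N L : ℕ} {ν : ℕ → ℕ} {π : ℕ → ℕ → ℕ} {a b : ℕ} (hc : Corner N L ν a b) (h : IsSkewPP N L ν π) :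
    IsSkewPP N L (Function.update ν a (b+1)) (fwd a b π) := by
  have hB := tog_bounds (bounds0 (corner_shape hc) h) h.1
  obtain ⟨z, r, c⟩ := h
  simp only [IsSkewPP, shape_upd hc]
  refine ⟨?_, ?_, ?_⟩
  · intro i j hij
    unfold fwd
    split_ifs with q
    · rfl
    by_cases p : a < i ∧ i + b = j + a
    · by_cases t : N ≤ i ∨ L ≤ j
      · have := hB i j p.1 p.2
        have := tog_zero z i j p.1 p.2 t
        omega
      · exact absurd ⟨(corner_shape hc i j p.1 p.2 (by omega) (by omega)).1, q⟩ hij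
    · rw [tog_ndiag p]
      exact z _ _ (fun s => hij ⟨s, q⟩)
  · intro i j ⟨s1, t1⟩ ⟨s2, t2⟩
    have := r i j s1 s2
    rw [fwd, fwd, if_neg t1, if_neg t2]
    by_cases p : a < i ∧ i + b = j + a
    · have h1 := hB i j p.1 p.2
      rw [tog_ndiag (i := i) (j := j+1) (by omega)]
      omega
    · rw [tog_ndiag p]
      by_cases p : a < i ∧ i + b = j + 1 + a
      · have h1 := hB i (j+1) p.1 p.2
        rw [Nat.add_sub_cancel] at h1
        omega
      · rwa [tog_ndiag p]
  · intro i j ⟨s1, t1⟩ ⟨s2, t2⟩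
    have := c i j s1 s2
    rw [fwd, fwd, if_neg t1, if_neg t2]
    by_cases p : a < i ∧ i + b = j + a
    · have h1 := hB i j p.1 p.2
      rw [tog_ndiag (i := i+1) (j := j) (by omega)]
      omega
    · rw [tog_ndiag p]
      by_cases p : a < i + 1 ∧ i + 1 + b = j + a
      · have h1 := hB (i+1) j p.1 p.2
        rw [Nat.add_sub_cancel] at h1
        omega
      · rwa [tog_ndiag p]

lemma bwd_ok {N L : ℕ} {ν : ℕ → ℕ} {π : ℕ → ℕ → ℕ} {a b : ℕ} (k : ℕ) (hc : Corner N L ν a b)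
    (h : IsSkewPP N L (Function.update ν a (b+1)) π) :
    IsSkewPP N L ν (bwd a b k π) := by
  have hB := tog_bounds (bounds0 (corner_shape' hc) h) h.1
  have hz := tog_zero (a := a) (b := b) h.1
  obtain ⟨z, r, c⟩ := h
  simp only [shape_upd hc] at z r c
  have hab : InShape N L ν a b := by
    obtain ⟨c1, c2, c3, c4, c5⟩ := hc
    unfold InShape; omega
  refine ⟨?_, ?_, ?_⟩
  · intro i j hij
    unfold bwd
    split_ifs with q
    · rw [q.1, q.2] at hij; exact absurd hab hij
    by_cases p : a < i ∧ i + b = j + a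
    · by_cases t : N ≤ i ∨ L ≤ j
      · have := hB i j p.1 p.2
        have := hz i j p.1 p.2 t
        omega
      · exact absurd (corner_shape hc i j p.1 p.2 (by omega) (by omega)).1 hij
    · rw [tog_ndiag p]
      exact z _ _ (fun s => hij s.1)
  · intro i j s1 s2
    by_cases t2 : i = a ∧ j + 1 = b
    · obtain ⟨c1, c2, c3, c4, c5⟩ := hc
      rw [t2.1] at s1
      unfold InShape at s1; omega
    by_cases t1 : i = a ∧ j = b
    · obtain ⟨rfl, rfl⟩ := t1
      rw [bwd, bwd, if_neg t2, if_pos ⟨rfl, rfl⟩, tog_ndiag (by omega)]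
      omega
    have := r i j ⟨s1, t1⟩ ⟨s2, t2⟩
    rw [bwd, bwd, if_neg t1, if_neg t2]
    by_cases p : a < i ∧ i + b = j + a
    · have h1 := hB i j p.1 p.2
      rw [tog_ndiag (i := i) (j := j+1) (by omega)]
      omega
    · rw [tog_ndiag p]
      by_cases p : a < i ∧ i + b = j + 1 + a
      · have h1 := hB i (j+1) p.1 p.2
        rw [Nat.add_sub_cancel] at h1
        omega
      · rwa [tog_ndiag p]
  · intro i j s1 s2
    by_cases t2 : i + 1 = a ∧ j = b
    · obtain ⟨c1, c2, c3, c4, c5⟩ := hc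
      have := c4 i (by omega)
      unfold InShape at s1; omega
    by_cases t1 : i = a ∧ j = b
    · obtain ⟨rfl, rfl⟩ := t1
      rw [bwd, bwd, if_neg t2, if_pos ⟨rfl, rfl⟩, tog_ndiag (by omega)]
      omega
    have := c i j ⟨s1, t1⟩ ⟨s2, t2⟩
    rw [bwd, bwd, if_neg t1, if_neg t2]
    by_cases p : a < i ∧ i + b = j + a
    · have h1 := hB i j p.1 p.2
      rw [tog_ndiag (i := i+1) (j := j) (by omega)]
      omega
    · rw [tog_ndiag p]
      by_cases p : a < i + 1 ∧ i + 1 + b = j + a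
      · have h1 := hB (i+1) j p.1 p.2
        rw [Nat.add_sub_cancel] at h1
        omega
      · rwa [tog_ndiag p]

lemma tog_invol {a b : ℕ} {π ρ : ℕ → ℕ → ℕ} 
    (hρ : ∀ i j, ¬ (i = a ∧ j = b) → ρ i j = tog a b π i j)
    (h : ∀ i j, a < i → i + b = j + a → tog a b π i j + π i j = min (π (i-1) j) (π i (j-1)) + max (π (i+1) j) (π i (j+1)))
    (i j : ℕ) (hij : ¬ (i = a ∧ j = b)) : tog a b ρ i j = π i j := by
  by_cases p : a < i ∧ i + b = j + a
  · have := h i j p.1 p.2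
    have e : tog a b ρ i j = min (ρ (i-1) j) (ρ i (j-1)) + max (ρ (i+1) j) (ρ i (j+1)) - ρ i j := by
      simp [tog, p]
    rw [e, hρ i j hij, hρ _ _ (by omega), hρ _ _ (by omega), hρ _ _ (by omega), hρ _ _ (by omega),
      tog_ndiag (i := i-1) (by omega), tog_ndiag (j := j-1) (by omega), 
      tog_ndiag (i := i+1) (by omega), tog_ndiag (j := j+1) (by omega)]
    omega
  · rw [tog_ndiag p, hρ _ _ hij, tog_ndiag p]

lemma corner_ge {N L : ℕ} {ν : ℕ → ℕ} {π : ℕ → ℕ → ℕ} {a b : ℕ} (hc : Corner N L ν a b) (h : IsSkewPP N L ν π) :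
    max (π (a+1) b) (π a (b+1)) ≤ π a b := by
  have hab : InShape N L ν a b := by
    obtain ⟨c1, c2, c3, c4, c5⟩ := hc
    unfold InShape; omega
  obtain ⟨z, r, c⟩ := h
  refine max_le ?_ ?_
  · by_cases q : InShape N L ν (a+1) b
    · exact c _ _ hab q
    · simp [z _ _ q]
  · by_cases q : InShape N L ν a (b+1)
    · exact r _ _ hab q
    · simp [z _ _ q]

abbrev PP (N L : ℕ) (ν : ℕ → ℕ) := {π : ℕ → ℕ → ℕ // IsSkewPP N L ν π}

def stepEquiv {N L : ℕ} {ν} {a b : ℕ} (hc : Corner N L ν a b) :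
    PP N L ν ≃ ℕ × PP N L (Function.update ν a (b+1)) where
  toFun π := (π.1 a b - max (π.1 (a+1) b) (π.1 a (b+1)), ⟨fwd a b π.1, fwd_ok hc π.2⟩)
  invFun p := ⟨bwd a b p.1 p.2.1, bwd_ok p.1 hc p.2.2⟩
  left_inv := by
    rintro ⟨π, h⟩
    apply Subtype.ext
    funext i j
    simp only
    by_cases q : i = a ∧ j = b
    · obtain ⟨rfl, rfl⟩ := q
      have := corner_ge hc h
      rw [bwd, if_pos ⟨rfl, rfl⟩, fwd, fwd, if_neg (by omega), if_neg (by omega), tog_ndiag (by omega), tog_ndiag (by omega)]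
      omega
    · rw [bwd, if_neg q]
      exact tog_invol (fun i j q => by rw [fwd, if_neg q]) 
        (fun i j h1 h2 => (tog_bounds (bounds0 (corner_shape hc) h) h.1 i j h1 h2).2.2) i j q
  right_inv := by
    rintro ⟨k, ⟨π, h⟩⟩
    refine Prod.ext ?_ (Subtype.ext ?_)
    · simp only
      rw [bwd, if_pos ⟨rfl, rfl⟩, bwd, bwd, if_neg (by omega), if_neg (by omega), tog_ndiag (by omega), tog_ndiag (by omega)]
      omega
    · funext i j
      simp only
      by_cases q : i = a ∧ j = b
      · rw [fwd, if_pos q]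
        exact (h.1 i j (by rw [shape_upd hc]; tauto)).symm
      · rw [fwd, if_neg q]
        exact tog_invol (fun i j q => by rw [bwd, if_neg q]) 
          (fun i j h1 h2 => (tog_bounds (bounds0 (corner_shape' hc) h) h.1 i j h1 h2).2.2) i j q

def W (N L : ℕ) (y : ℤ → ℤ) (π : ℕ → ℕ → ℕ) : ℤ :=
  ∑ i ∈ range N, ∑ j ∈ range L, (y ((j:ℤ) - i + 1) - y ((j:ℤ) - i)) * (π i j : ℤ)

lemma diagSum (N L a b : ℕ) (F : ℕ → ℕ → ℤ) (ha : a ≤ N) (hF0 : ∀ i j, L ≤ j → F i j = 0)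
    (hF1 : ∀ i j : ℕ, i < a → (j:ℤ) - i = b - a → F i j = 0) :
    ∑ i ∈ range N, ∑ j ∈ range L, (if (j:ℤ) - i = b - a then F i j else 0)
      = ∑ t ∈ range (N - a), F (a+t) (b+t) := by
  obtain ⟨M, rfl⟩ := Nat.exists_eq_add_of_le ha
  rw [Finset.sum_range_add, Finset.sum_eq_zero, zero_add, Nat.add_sub_cancel_left]
  · refine Finset.sum_congr rfl fun t _ => ?_
    have : ∀ j : ℕ, ((j:ℤ) - ((a + t : ℕ):ℤ) = b - a) ↔ j = b + t := by intro j; push_cast; omega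
    simp only [this, Finset.sum_ite_eq', Finset.mem_range]
    split_ifs with q
    · rfl
    · exact (hF0 _ _ (by omega)).symm
  · intro i hi
    refine Finset.sum_eq_zero fun j _ => ?_
    split_ifs with q
    · exact hF1 i j (by simpa using hi) q
    · rfl

lemma telesc (p p' u v : ℕ → ℤ) (k : ℤ) (h0 : p 0 = k + max (u 0) (v 0)) (h0' : p' 0 = 0)
    (h : ∀ t, p (t+1) + p' (t+1) = min (u t) (v t) + max (u (t+1)) (v (t+1))) (T : ℕ) :
    ∑ t ∈ range (T+1), (p t + p' t) + min (u T) (v T) = k + ∑ t ∈ range (T+1), (u t + v t) := by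
  induction T with
  | zero =>
    simp only [zero_add, Finset.sum_range_one, h0, h0']
    have := min_add_max (u 0) (v 0)
    linarith
  | succ T ih =>
    rw [Finset.sum_range_succ, Finset.sum_range_succ (fun t => u t + v t), h]
    have := min_add_max (u (T+1)) (v (T+1))
    linarith

lemma W_step {N L : ℕ} {ν : ℕ → ℕ} {π : ℕ → ℕ → ℕ} {a b : ℕ} (hc : Corner N L ν a b)
    (h : IsSkewPP N L ν π) (y : ℤ → ℤ) :
    W N L y π = (y ((b:ℤ) - a + 1) - y ((b:ℤ) - a)) *
      ((π a b - max (π (a+1) b) (π a (b+1)) : ℕ) : ℤ)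
      + W N L (y ∘ Equiv.swap ((b:ℤ) - a) ((b:ℤ) - a + 1)) (fwd a b π) := by
  have hB := tog_bounds (bounds0 (corner_shape hc) h) h.1
  have hge := corner_ge hc h
  have hF := (fwd_ok hc h).1
  have hz := h.1
  obtain ⟨c1, c2, c3, c4, c5⟩ := hc
  set k := π a b - max (π (a+1) b) (π a (b+1)) with hk
  have T := telesc (fun t => (π (a+t) (b+t) : ℤ)) (fun t => (fwd a b π (a+t) (b+t) : ℤ))
    (fun t => (π (a+1+t) (b+t) : ℤ)) (fun t => (π (a+t) (b+1+t) : ℤ)) k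
    (by simp only [add_zero]; omega) (by simp [fwd])
    (by
      intro t
      have := (hB (a+(t+1)) (b+(t+1)) (by omega) (by omega)).2.2
      have e : fwd a b π (a+(t+1)) (b+(t+1)) = tog a b π (a+(t+1)) (b+(t+1)) := by
        rw [fwd, if_neg (by omega)]
      rw [e]
      rw [show a+(t+1)-1 = a+t by omega, show b+(t+1)-1 = b+t by omega] at this
      rw [show a+1+t = a+(t+1) by ring, show b+1+t = b+(t+1) by ring,
        show a+1+(t+1) = a+(t+1)+1 by ring, show b+1+(t+1) = b+(t+1)+1 by ring]
      omega) (N - a - 1)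
  rw [show N - a - 1 + 1 = N - a by omega] at T
  have hmin : π (a+1+(N-a-1)) (b+(N-a-1)) = 0 := hz _ _ (by unfold InShape; omega)
  simp only [hmin] at T
  have d0 := diagSum N L a b (fun i j => (π i j : ℤ) + fwd a b π i j) c1.le
    (fun i j hj => by
      rw [hz i j (by unfold InShape; omega), hF i j (by unfold InShape; omega)]; rfl)
    (fun i j hi hj => by
      have := c4 i hi
      have e : π i j = 0 := hz i j (by unfold InShape; omega)
      rw [fwd, if_neg (by omega), tog_ndiag (by omega), e]; rfl)
  have d1 := diagSum N L (a+1) b (fun i j => (π i j : ℤ)) c1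
    (fun i j hj => by
      rw [hz i j (by unfold InShape; omega)]; rfl)
    (fun i j hi hj => by
      have e : π i j = 0 := hz i j (by 
        unfold InShape
        rcases (show i ≤ a by omega).eq_or_lt with q | q
        · subst q; push_cast at hj; omega
        · have := c4 i q; push_cast at hj; omega)
      rw [e]; rfl)
  have d2 := diagSum N L a (b+1) (fun i j => (π i j : ℤ)) c1.le
    (fun i j hj => by
      rw [hz i j (by unfold InShape; omega)]; rfl)
    (fun i j hi hj => by
      have := c4 i hi
      have e : π i j = 0 := hz i j (by unfold InShape; push_cast at hj; omega)
      rw [e]; rfl)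
  have d1' : ∑ t ∈ range (N - a), (π (a+1+t) (b+t) : ℤ) = ∑ t ∈ range (N - (a+1)), (π (a+1+t) (b+t) : ℤ) := by
    rw [show N - a = N - (a+1) + 1 by omega, Finset.sum_range_succ, show N - (a+1) = N - a - 1 by omega,
      hmin]; simp
  have hmain : W N L y π - W N L (y ∘ Equiv.swap ((b:ℤ) - a) ((b:ℤ) - a + 1)) (fwd a b π)
      = (y ((b:ℤ) - a + 1) - y ((b:ℤ) - a)) * (
      (∑ i ∈ range N, ∑ j ∈ range L, (if (j:ℤ) - i = b - a then ((π i j : ℤ) + fwd a b π i j) else 0))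
      - (∑ i ∈ range N, ∑ j ∈ range L, (if (j:ℤ) - i = b - ((a+1:ℕ):ℤ) then (π i j : ℤ) else 0))
      - (∑ i ∈ range N, ∑ j ∈ range L, (if (j:ℤ) - i = ((b+1:ℕ):ℤ) - a then (π i j : ℤ) else 0))) := by
    unfold W
    simp only [← Finset.sum_sub_distrib, Finset.mul_sum]
    refine Finset.sum_congr rfl fun i _ => Finset.sum_congr rfl fun j _ => ?_
    have hoff : ((j:ℤ) - i ≠ b - a) → fwd a b π i j = π i j := by
      intro q
      rw [fwd, if_neg (by omega), tog_ndiag (by omega)]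
    simp only [Function.comp]
    generalize hd : (b:ℤ) - a = d at *
    generalize he : (j:ℤ) - i = e at *
    rw [show (b:ℤ) - ((a+1:ℕ):ℤ) = d - 1 by push_cast; omega, show ((b+1:ℕ):ℤ) - a = d + 1 by push_cast; omega]
    by_cases q : e = d
    · subst q
      rw [Equiv.swap_apply_left, Equiv.swap_apply_right, if_pos rfl, if_neg (by omega), if_neg (by omega)]
      ring
    · rw [hoff q, if_neg q]
      by_cases q1 : e = d - 1
      · rw [if_pos q1, if_neg (by omega), show e + 1 = d by omega, Equiv.swap_apply_left,
          Equiv.swap_apply_of_ne_of_ne (by omega) (by omega)]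
        ring
      · rw [if_neg q1]
        by_cases q2 : e = d + 1
        · rw [if_pos q2]
          nth_rewrite 4 [q2]
          rw [Equiv.swap_apply_right, Equiv.swap_apply_of_ne_of_ne (by omega) (by omega), q2]
          ring
        · rw [if_neg q2, Equiv.swap_apply_of_ne_of_ne (by omega) (by omega),
            Equiv.swap_apply_of_ne_of_ne (by omega) (by omega)]
          ring
  rw [d0, d1, d2, ← d1'] at hmain
  simp only [Finset.sum_add_distrib] at T hmain
  have e0 : min ((0:ℕ):ℤ) (π (a + (N-a-1)) (b+1+(N-a-1)) : ℤ) = 0 := by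
    simp
  rw [e0] at T
  rw [show ((∑ x ∈ range (N - a), (π (a + x) (b + x) : ℤ) + ∑ x ∈ range (N - a), (fwd a b π (a + x) (b + x):ℤ)) -
            ∑ t ∈ range (N - a), (π (a + 1 + t) (b + t) : ℤ) -
          ∑ t ∈ range (N - a), (π (a + t) (b + 1 + t) : ℤ)) = (k:ℤ) by linarith] at hmain
  linarith

def SC (N L : ℕ) (ν : ℕ → ℕ) : Finset (ℕ × ℕ) :=
  (range N ×ˢ range L).filter fun p => ν p.1 ≤ p.2

lemma mem_SC {N L ν p} : p ∈ SC N L ν ↔ InShape N L ν p.1 p.2 := by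
  unfold SC InShape
  simp; tauto

def hk (y : ℤ → ℤ) (ν μ : ℕ → ℕ) (p : ℕ × ℕ) : ℤ :=
  y ((p.2:ℤ) - μ p.2 + 1) - y ((ν p.1 : ℤ) - p.1)

lemma SC_step {N L : ℕ} {ν : ℕ → ℕ} {a b : ℕ} (hc : Corner N L ν a b) :
    (a,b) ∉ SC N L (Function.update ν a (b+1)) ∧ 
    SC N L ν = insert (a,b) (SC N L (Function.update ν a (b+1))) := by
  have hab : InShape N L ν a b := by
    obtain ⟨c1, c2, c3, c4, c5⟩ := hc
    unfold InShape; omega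
  constructor
  · rw [mem_SC, shape_upd hc]; simp
  · ext ⟨i, j⟩
    rw [Finset.mem_insert, mem_SC, mem_SC, shape_upd hc, Prod.mk.injEq]
    by_cases q : i = a ∧ j = b
    · rw [q.1, q.2]; simpa using hab
    · simp [q]

lemma hk_step {N L : ℕ} {ν μ : ℕ → ℕ} {a b : ℕ} (hc : Corner N L ν a b)
    (hrel : ∀ i j, j < ν i ↔ i < μ j) (hμ : μ b = a) (y : ℤ → ℤ) (p : ℕ × ℕ) :
    hk (y ∘ Equiv.swap ((b:ℤ) - a) ((b:ℤ) - a + 1)) (Function.update ν a (b+1))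
      (Function.update μ b (a+1)) p = hk y ν μ p := by
  obtain ⟨c1, c2, c3, c4, c5⟩ := hc
  obtain ⟨i, j⟩ := p
  unfold hk
  simp only [Function.comp]
  congr 1
  · by_cases q : j = b
    · subst q
      rw [Function.update_self, hμ, show (j:ℤ) - ((a+1:ℕ):ℤ) + 1 = j - a by push_cast; ring,
        Equiv.swap_apply_left]
    · rw [Function.update_of_ne q]
      have h1 := hrel a j
      have h2 := hrel (μ j) b
      have h3 := hrel (μ j) j
      have h4 := hrel (μ b) j
      have h5 := hrel a b
      have : (j:ℤ) - μ j + 1 ≠ b - a ∧ (j:ℤ) - μ j + 1 ≠ b - a + 1 := by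
        rcases Nat.lt_or_gt_of_ne q with q | q
        · omega
        · have : μ j ≤ a := by
            by_contra hh
            have := (hrel a j).2 (by omega)
            omega
          omega
      rw [Equiv.swap_apply_of_ne_of_ne this.1 this.2]
  · by_cases q : i = a
    · subst q
      rw [Function.update_self, c3, show ((b+1:ℕ):ℤ) - i = b - i + 1 by push_cast; ring,
        Equiv.swap_apply_right]
    · rw [Function.update_of_ne q]
      have : (ν i:ℤ) - i ≠ b - a ∧ (ν i:ℤ) - i ≠ b - a + 1 := by
        rcases Nat.lt_or_gt_of_ne q with q | q
        · have := c4 i q; omega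
        · have := c5 i q; omega
      rw [Equiv.swap_apply_of_ne_of_ne this.1 this.2]

theorem gf_main (N L : ℕ) : ∀ (c : ℕ) (ν μ : ℕ → ℕ) (y : ℤ → ℤ), (SC N L ν).card = c →
    (∀ i j, j < ν i ↔ i < μ j) → (∀ i, ν i ≤ L) → (∀ p ∈ SC N L ν, 0 < hk y ν μ p) →
    ∃ Q, HasGF (fun π : PP N L ν => W N L y π.1) Q ∧
      Q * ∏ p ∈ SC N L ν, (1 - (X : PowerSeries ℤ) ^ (hk y ν μ p).toNat) = 1 := by
  intro c
  induction c with
  | zero =>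
    intro ν μ y hcard hrel hL hpos
    have hS : SC N L ν = ∅ := Finset.card_eq_zero.1 hcard
    have hno : ∀ i j, ¬ InShape N L ν i j := by
      intro i j h
      have : (i,j) ∈ SC N L ν := mem_SC.2 h
      rw [hS] at this; simp at this
    refine ⟨1, ?_, by rw [hS]; simp⟩
    have hW : ∀ π : PP N L ν, W N L y π.1 = 0 := by
      intro π
      unfold W
      refine Finset.sum_eq_zero fun i _ => Finset.sum_eq_zero fun j _ => ?_
      rw [π.2.1 i j (hno i j)]; simp
    have hsub : Subsingleton (PP N L ν) := ⟨fun π ρ => Subtype.ext (by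
      funext i j; rw [π.2.1 i j (hno i j), ρ.2.1 i j (hno i j)])⟩
    let z0 : PP N L ν := ⟨fun _ _ => 0, by refine ⟨?_, ?_, ?_⟩ <;> intros <;> simp⟩
    refine ⟨fun π => (hW π).ge, fun n => ⟨inferInstance, ?_⟩⟩
    rw [PowerSeries.coeff_one]
    split_ifs with hn
    · subst hn
      have : Unique {π : PP N L ν // W N L y π.1 = ((0:ℕ):ℤ)} :=
        ⟨⟨⟨z0, by rw [hW]; rfl⟩⟩, fun x => Subsingleton.elim _ _⟩
      rw [Nat.card_unique]; rfl
    · have : IsEmpty {π : PP N L ν // W N L y π.1 = (n:ℤ)} :=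
        ⟨fun x => hn (by have := x.2; rw [hW] at this; exact_mod_cast this.symm)⟩
      rw [Nat.card_of_isEmpty]; rfl
  | succ c ih =>
    intro ν μ y hcard hrel hL hpos
    have hex : ∃ a, a < N ∧ ν a < L := by
      obtain ⟨p, hp⟩ := Finset.card_pos.1 (show 0 < (SC N L ν).card by omega)
      rw [mem_SC] at hp
      unfold InShape at hp
      exact ⟨p.1, by omega, by omega⟩
    classical
    obtain ⟨a, ⟨ha1, ha2⟩, hmin⟩ : ∃ a, (a < N ∧ ν a < L) ∧ ∀ i, i < a → ¬ (i < N ∧ ν i < L) :=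
      ⟨Nat.find hex, Nat.find_spec hex, fun i hi => Nat.find_min hex hi⟩
    obtain ⟨b, hb⟩ : ∃ b, b = ν a := ⟨_, rfl⟩
    have hc : Corner N L ν a b := by
      refine ⟨ha1, by omega, hb.symm, ?_, ?_⟩
      · intro i hi
        have := hmin i hi
        omega
      · intro i hi
        by_contra hh
        have h1 := (hrel i b).1 (by omega)
        have h2 := (hrel a b).2 (by omega)
        omega
    have hμ : μ b = a := by
      have h1 := hrel a b
      rcases lt_trichotomy (μ b) a with q | q | q
      · have := hc.2.2.2.1 _ q
        have := (hrel (μ b) b).1 this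
        omega
      · exact q
      · omega
    obtain ⟨hnot, hins⟩ := SC_step hc
    have hpos0 := hpos (a,b) (by rw [hins]; simp)
    obtain ⟨Q', hQ', hprod⟩ := ih (Function.update ν a (b+1)) (Function.update μ b (a+1))
      (y ∘ Equiv.swap ((b:ℤ) - a) ((b:ℤ) - a + 1)) (by
        rw [hins, Finset.card_insert_of_notMem hnot] at hcard; omega)
      (by
        intro i j
        have := hrel i j
        have := hrel a j
        have := hrel i b
        simp only [Function.update_apply]
        split_ifs with q1 q2 q2
        · omega
        · subst q1; omega
        · subst q2; omega
        · omega)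
      (by
        intro i
        have := hL i
        simp only [Function.update_apply]
        split_ifs <;> omega)
      (by
        intro p hp
        rw [hk_step hc hrel hμ]
        exact hpos p (by rw [hins]; exact Finset.mem_insert_of_mem hp))
    simp only [hk_step hc hrel hμ] at hprod
    have hkab : hk y ν μ (a,b) = y ((b:ℤ) - a + 1) - y ((b:ℤ) - a) := by
      unfold hk; simp only [hμ, ← hb]
    obtain ⟨h, hh⟩ := Int.eq_ofNat_of_zero_le hpos0.le
    have hh0 : 0 < h := by omega
    have hunit : IsUnit (1 - (X : PowerSeries ℤ) ^ h) := by
      rw [PowerSeries.isUnit_iff_constantCoeff]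
      simp [hh0.ne']
    obtain ⟨V, hV⟩ := hunit.exists_left_inv
    refine ⟨Q' * V, ?_, ?_⟩
    · refine HasGF.congr (stepEquiv hc) ?_ (HasGF.step h hh0 hQ' (Q := Q' * V) (by rw [mul_assoc, hV, mul_one]))
      intro π
      rw [W_step hc π.2 y, ← hkab, hh]
      rfl
    · rw [hins, Finset.prod_insert hnot, hh, Int.toNat_natCast]
      calc _ = (Q' * ∏ p ∈ SC N L (Function.update ν a (b+1)), (1 - (X : PowerSeries ℤ) ^ (hk y ν μ p).toNat)) * (V * (1 - X^h)) := by ring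
        _ = 1 := by rw [hprod, hV, one_mul]

def fac (m : ℕ) : PowerSeries ℤ := ∏ t ∈ range m, (1 - (X : PowerSeries ℤ) ^ (t + 1))

lemma one_sub_ne (n : ℕ) (hn : 0 < n) : (1 - (X : PowerSeries ℤ) ^ n) ≠ 0 := by
  intro h
  have := congrArg (PowerSeries.constantCoeff (R := ℤ)) h
  simp [hn.ne'] at this

lemma fac_ne (m : ℕ) : fac m ≠ 0 :=
  Finset.prod_ne_zero_iff.2 fun t _ => one_sub_ne _ (by omega)

lemma fac_add (m k : ℕ) : fac (m + k) = fac m * ∏ t ∈ range k, (1 - (X : PowerSeries ℤ) ^ (m + t + 1)) := by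
  unfold fac; rw [Finset.prod_range_add]

lemma conj_rel {μ : ℕ → ℕ} (hμ : IsPartition μ) (i j : ℕ) : j < conj μ i ↔ i < μ j := by
  obtain ⟨ha, n, hn⟩ := hμ
  have hex : ∃ m, μ m ≤ i := ⟨n, by omega⟩
  classical
  have : {k | i + 1 ≤ μ k} = ((range (Nat.find hex) : Finset ℕ) : Set ℕ) := by
    ext k
    simp only [Set.mem_ofPred_eq, Finset.coe_range, Set.mem_Iio]
    constructor
    · intro h
      by_contra q
      have := ha (not_lt.1 q)
      have := Nat.find_spec hex
      omega
    · intro h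
      have := Nat.find_min hex h
      omega
  unfold conj
  rw [this, Set.ncard_coe_finset, Finset.card_range]
  constructor
  · intro h
    have := Nat.find_min hex h
    omega
  · intro h
    by_contra q
    have := ha (not_lt.1 q)
    have := Nat.find_spec hex
    omega

lemma cells_prod {N : ℕ} {μ ν : ℕ → ℕ} (hrel : ∀ i j, j < ν i ↔ i < μ j)
    (hν : ν = conj μ) (h1 : μ 0 ≤ N) (f : ℕ × ℕ → PowerSeries ℤ) :
    ∏ p ∈ cells μ, f p = ∏ i ∈ range N, ∏ j ∈ range (ν i), f (j, i) := by
  rw [Finset.prod_sigma']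
  symm
  refine Finset.prod_nbij' (fun s => (s.2, s.1)) (fun p => ⟨p.2, p.1⟩) ?_ ?_ ?_ ?_ ?_
  · rintro ⟨i, j⟩ h
    simp only [Finset.mem_sigma, Finset.mem_range] at h
    simp only [cells, Finset.mem_filter, Finset.mem_product, Finset.mem_range, ← hν]
    have e1 := (hrel i j).1 h.2
    have e2 := (hrel i 0).1 (by omega)
    have e3 := (hrel 0 j).2 (by omega)
    omega
  · rintro ⟨j, i⟩ h
    simp only [cells, Finset.mem_filter, Finset.mem_product, Finset.mem_range] at h
    simp only [Finset.mem_sigma, Finset.mem_range]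
    exact ⟨by omega, (hrel i j).2 h.2⟩
  · rintro ⟨i, j⟩ h; rfl
  · rintro ⟨i, j⟩ h; rfl
  · rintro ⟨i, j⟩ h; rfl

lemma prodXY {N L : ℕ} {μ ν : ℕ → ℕ} (hrel : ∀ i j, j < ν i ↔ i < μ j)
    (hL : ∀ i, ν i ≤ L) (hN : ∀ j, μ j ≤ N) (f : ℤ → PowerSeries ℤ) :
    (∏ i ∈ range N, f ((ν i : ℤ) - i)) * ∏ j ∈ range L, f ((j : ℤ) - μ j + 1)
      = ∏ p ∈ Finset.Icc (1 - (N:ℤ)) L, f p := by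
  have aν : ∀ i k, i < k → ν k ≤ ν i := by
    intro i k h
    by_contra q
    have h1 := (hrel k (ν i)).1 (by omega)
    have h2 := (hrel i (ν i)).2 (by omega)
    omega
  have aμ : ∀ i k, i < k → μ k ≤ μ i := by
    intro i k h
    by_contra q
    have h1 := (hrel (μ i) k).2 (by omega)
    have h2 := (hrel (μ i) i).1 (by omega)
    omega
  have iν : Function.Injective (fun i : ℕ => (ν i : ℤ) - i) := by
    intro i k h
    simp only at h
    rcases lt_trichotomy i k with q | q | q
    · have := aν _ _ q; omega
    · exact q
    · have := aν _ _ q; omega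
  have iμ : Function.Injective (fun j : ℕ => (j : ℤ) - μ j + 1) := by
    intro i k h
    simp only at h
    rcases lt_trichotomy i k with q | q | q
    · have := aμ _ _ q; omega
    · exact q
    · have := aμ _ _ q; omega
  have hdis : Disjoint ((range N).image (fun i : ℕ => (ν i : ℤ) - i))
      ((range L).image (fun j : ℕ => (j : ℤ) - μ j + 1)) := by
    rw [Finset.disjoint_left]
    intro p h1 h2
    rw [Finset.mem_image] at h1 h2
    obtain ⟨i, _, hi⟩ := h1
    obtain ⟨j, _, hj⟩ := h2
    have := hrel i j
    omega
  have hU : ((range N).image (fun i : ℕ => (ν i : ℤ) - i)) ∪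
      ((range L).image (fun j : ℕ => (j : ℤ) - μ j + 1)) = Finset.Icc (1 - (N:ℤ)) L := by
    apply Finset.eq_of_subset_of_card_le
    · intro p hp
      rw [Finset.mem_union, Finset.mem_image, Finset.mem_image] at hp
      rw [Finset.mem_Icc]
      rcases hp with ⟨i, hi, rfl⟩ | ⟨j, hj, rfl⟩
      · have := hL i; rw [Finset.mem_range] at hi; omega
      · have := hN j; rw [Finset.mem_range] at hj; omega
    · rw [Finset.card_union_of_disjoint hdis, Finset.card_image_of_injective _ iν,
        Finset.card_image_of_injective _ iμ, Int.card_Icc]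
      simp only [Finset.card_range]
      omega
  rw [← hU, Finset.prod_union hdis, Finset.prod_image (fun _ _ _ _ h => iν h),
    Finset.prod_image (fun _ _ _ _ h => iμ h)]

lemma prod_low (A B x : ℤ) (h1 : A ≤ x) (h2 : x ≤ B) :
    ∏ p ∈ Finset.Icc A B, (if p < x then (1 - (X : PowerSeries ℤ) ^ (x - p).toNat) else 1)
      = fac (x - A).toNat := by
  rw [← Finset.prod_filter]
  unfold fac
  refine Finset.prod_nbij' (fun p => (x - p).toNat - 1) (fun t => x - (t + 1)) ?_ ?_ ?_ ?_ ?_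
  all_goals simp only [Finset.mem_filter, Finset.mem_Icc, Finset.mem_range]
  · intro p hp; omega
  · intro p hp; omega
  · intro p hp; omega
  · intro p hp; omega
  · intro p hp; congr 2; omega

lemma prod_high (A B x : ℤ) (h1 : A ≤ x) (h2 : x ≤ B) :
    ∏ p ∈ Finset.Icc A B, (if x < p then (1 - (X : PowerSeries ℤ) ^ (p - x).toNat) else 1)
      = fac (B - x).toNat := by
  rw [← Finset.prod_filter]
  unfold fac
  refine Finset.prod_nbij' (fun p => (p - x).toNat - 1) (fun t => x + (t + 1)) ?_ ?_ ?_ ?_ ?_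
  all_goals simp only [Finset.mem_filter, Finset.mem_Icc, Finset.mem_range]
  · intro p hp; omega
  · intro p hp; omega
  · intro p hp; omega
  · intro p hp; omega
  · intro p hp; congr 2; omega

lemma hook_identity {N L : ℕ} {μ ν : ℕ → ℕ} (hrel : ∀ i j, j < ν i ↔ i < μ j)
    (hν : ν = conj μ) (hL : ∀ i, ν i ≤ L) (hN : ∀ j, μ j ≤ N) :
    (∏ n ∈ range N, ∏ l ∈ range L, (1 - (X : PowerSeries ℤ) ^ (n + l + 1)))
        * (∏ p ∈ cells μ, (1 - (X : PowerSeries ℤ) ^ hook μ p))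
      = (∏ p ∈ cells μ,
          ((1 - (X : PowerSeries ℤ) ^ (N + p.1 - p.2)) *
            (1 - (X : PowerSeries ℤ) ^ (L + p.2 - p.1)))) *
        ∏ p ∈ SC N L ν, (1 - (X : PowerSeries ℤ) ^ (hk id ν μ p).toNat) := by
  let x : ℕ → ℤ := fun i => (ν i : ℤ) - i
  let D : PowerSeries ℤ := ∏ i ∈ range N, ∏ k ∈ range N,
    if x k < x i then (1 - (X : PowerSeries ℤ) ^ (x i - x k).toNat) else 1
  have hD : D ≠ 0 := by
    refine Finset.prod_ne_zero_iff.2 fun i _ => Finset.prod_ne_zero_iff.2 fun k _ => ?_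
    split_ifs with h
    · exact one_sub_ne _ (by omega)
    · exact one_ne_zero
  have hD' : D = ∏ i ∈ range N, ∏ k ∈ range N,
    if x i < x k then (1 - (X : PowerSeries ℤ) ^ (x k - x i).toNat) else 1 := Finset.prod_comm
  rw [Finset.prod_mul_distrib]
  set A := ∏ n ∈ range N, ∏ l ∈ range L, (1 - (X : PowerSeries ℤ) ^ (n + l + 1)) with hA
  set H := ∏ p ∈ cells μ, (1 - (X : PowerSeries ℤ) ^ hook μ p) with hH
  set B1 := ∏ p ∈ cells μ, (1 - (X : PowerSeries ℤ) ^ (N + p.1 - p.2)) with hB1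
  set B2 := ∏ p ∈ cells μ, (1 - (X : PowerSeries ℤ) ^ (L + p.2 - p.1)) with hB2
  set S := ∏ p ∈ SC N L ν, (1 - (X : PowerSeries ℤ) ^ (hk id ν μ p).toNat) with hS
  let F := ∏ i ∈ range N, fac i
  have hF : F ≠ 0 := Finset.prod_ne_zero_iff.2 fun i _ => fac_ne i
  have hF' : F = ∏ i ∈ range N, fac (N - 1 - i) := (Finset.prod_range_reflect _ _).symm
  let P1 := ∏ i ∈ range N, fac (N - 1 - i + ν i)
  let P2 := ∏ i ∈ range N, fac (L + i - ν i)
  let P3 := ∏ i ∈ range N, fac (i + L)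
  have e1 : F * A = P3 := by
    rw [hA, ← Finset.prod_mul_distrib]
    exact Finset.prod_congr rfl fun i _ => (fac_add i L).symm
  have e2 : F * B1 = P1 := by
    rw [hF', hB1, cells_prod hrel hν (hN 0), ← Finset.prod_mul_distrib]
    refine Finset.prod_congr rfl fun i hi => ?_
    rw [Finset.mem_range] at hi
    rw [fac_add]
    congr 1
    refine Finset.prod_congr rfl fun j hj => ?_
    simp only
    congr 2
    omega
  have e3 : P2 * B2 = P3 := by
    rw [hB2, cells_prod hrel hν (hN 0), ← Finset.prod_mul_distrib]
    refine Finset.prod_congr rfl fun i hi => ?_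
    have := hL i
    rw [show i + L = L + i - ν i + ν i by omega, fac_add]
    congr 1
    rw [← Finset.prod_range_reflect]
    refine Finset.prod_congr rfl fun j hj => ?_
    rw [Finset.mem_range] at hj
    simp only
    congr 2
    omega
  have e4 : D * H = P1 := by
    rw [hH, cells_prod hrel hν (hN 0), ← Finset.prod_mul_distrib]
    refine Finset.prod_congr rfl fun i hi => ?_
    rw [Finset.mem_range] at hi
    have hLi := hL i
    have := prodXY hrel hL hN (fun p => if p < x i then (1 - (X : PowerSeries ℤ) ^ (x i - p).toNat) else 1)
    rw [prod_low _ _ _ (by simp only [x]; omega) (by simp only [x]; omega)] at this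
    rw [show N - 1 - i + ν i = (x i - (1 - (N:ℤ))).toNat by simp only [x]; omega, ← this]
    congr 1
    rw [← Finset.prod_filter]
    refine Finset.prod_congr ?_ ?_
    · ext j
      rw [Finset.mem_filter, Finset.mem_range, Finset.mem_range]
      have := hrel i j
      simp only [x]
      omega
    · intro j hj
      rw [Finset.mem_filter, Finset.mem_range] at hj
      have := hrel i j
      simp only [hook, ← hν, x]
      congr 2
      simp only [x] at hj
      omega
  have e5 : D * S = P2 := by
    rw [hS, SC, Finset.prod_filter, Finset.prod_product, hD', ← Finset.prod_mul_distrib]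
    refine Finset.prod_congr rfl fun i hi => ?_
    rw [Finset.mem_range] at hi
    have hLi := hL i
    have := prodXY hrel hL hN (fun p => if x i < p then (1 - (X : PowerSeries ℤ) ^ (p - x i).toNat) else 1)
    rw [prod_high _ _ _ (by simp only [x]; omega) (by simp only [x]; omega)] at this
    rw [show L + i - ν i = ((L:ℤ) - x i).toNat by simp only [x]; omega, ← this]
    congr 1
    refine Finset.prod_congr rfl fun j hj => ?_
    have := hrel i j
    simp only [hk, id, x]
    by_cases q : ν i ≤ j
    · rw [if_pos q, if_pos (by omega)]
    · rw [if_neg q, if_neg (by omega)]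
  have hDF : D * F ≠ 0 := mul_ne_zero hD hF
  apply mul_left_cancel₀ hDF
  calc D * F * (A * H) = (F * A) * (D * H) := by ring
    _ = (F * B1) * ((D * S) * B2) := by rw [e1, e4, e2, e5, e3]; ring
    _ = _ := by ring

lemma W_id (N L : ℕ) (π : ℕ → ℕ → ℕ) : W N L id π = ppSize N L π := by
  unfold W ppSize
  push_cast
  refine Finset.sum_congr rfl fun i _ => Finset.sum_congr rfl fun j _ => ?_
  simp

/-- for a partition `μ` with `μ₁ ≤ N` and `μᵗ₁ ≤ L`, the generating function of
skew plane partitions of shape `(N×L) ∖ μᵗ` satisfies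
`Z_{N,L,μ} · ∏_{1≤n≤N,1≤l≤L}(1−q^{n+l−1}) · ∏_{(i,j)∈μ}(1−q^{h(i,j)})
  = ∏_{(i,j)∈μ}(1−q^{N−c(i,j)})(1−q^{L+c(i,j)})` in `ℤ[[q]]`. -/
theorem stmt0 (N L : ℕ) (μ : ℕ → ℕ) (hμ : IsPartition μ)
    (h1 : μ 0 ≤ N) (h2 : conj μ 0 ≤ L) :
    Z N L μ * (∏ n ∈ range N, ∏ l ∈ range L, (1 - (X : PowerSeries ℤ) ^ (n + l + 1)))
        * (∏ p ∈ cells μ, (1 - (X : PowerSeries ℤ) ^ hook μ p))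
      = ∏ p ∈ cells μ,
          ((1 - (X : PowerSeries ℤ) ^ (N + p.1 - p.2)) *
            (1 - (X : PowerSeries ℤ) ^ (L + p.2 - p.1))) := by
  have hrel := conj_rel hμ
  have hL : ∀ i, conj μ i ≤ L := by
    intro i
    by_contra q
    have a1 := (hrel i L).1 (by omega)
    have a2 := (hrel 0 L).2 (by omega)
    omega
  have hN : ∀ j, μ j ≤ N := fun j => (hμ.1 (Nat.zero_le j)).trans h1
  obtain ⟨Q, hQ, hprod⟩ := gf_main N L _ (conj μ) μ id rfl hrel hL (by
    intro p hp
    rw [mem_SC] at hp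
    have := hrel p.1 p.2
    unfold InShape at hp
    simp only [hk, id]
    omega)
  have hZ : Z N L μ = Q := by
    ext n
    rw [← (hQ.2 n).2, Z, PowerSeries.coeff_mk]
    congr 1
    refine Nat.card_congr ?_
    exact (Equiv.subtypeSubtypeEquivSubtypeInter _ (fun π => ppSize N L π = n)).symm.trans
      (Equiv.subtypeEquivRight (fun π => by simp only [W_id]; exact_mod_cast Iff.rfl))
  rw [hZ, mul_assoc, hook_identity hrel rfl hL hN, mul_left_comm, hprod, mul_one]

end
end

section
/- Fix partitions λ, μ, ν. Let P be the set of maps π : ℤ₊ × ℤ₊ → ℕ ∪ {∞}, weakly decreasing in each argument, such that π_{i,j} = ∞ exactly when j ≤ μᵗ_i, whose finite entries are bounded, and which stabilize: π_{i,j} = λᵗ_j for all sufficiently large i, and π_{i,j} = ν_i for all sufficiently large j. For an integer K define the diagonal truncated size t_K(π) = Σ_{(i,j): i−j ≤ K−1 and j−i ≤ K−1} min(π_{i,j}, K) and the box truncated size b_K(π) = Σ_{(i,j): i ≤ K, j ≤ K} min(π_{i,j}, K). Then for every π ∈ P and every sufficiently large K one has t_K(π) − b_K(π) = Σᵢ C(λᵢ,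 2) + Σᵢ C(νᵗᵢ, 2), where C(a,2) = a(a−1)/2. Consequently the modified sizes t_K(π) − K(|λ|+|μ|+|ν|) and b_K(π) − K(|λ|+|μ|+|ν|) are each independent of sufficiently large K, and the two generating functions satisfy q^{−ΣᵢC(λᵢ,2) − ΣᵢC(νᵗᵢ,2)} · Σ_{π∈P} q^{t_K(π) − K(|λ|+|μ|+|ν|)} = Σ_{π∈P} q^{b_K(π) − K(|λ|+|μ|+|ν|)} as elements of ℤ[[q]][q^{−1}]; i.e., the partition function of diagonal plane partitions equals that of perpendicular plane partitions when L = N = M = ∞. -/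
open Finset PowerSeries

noncomputable section

/-- `|μ| = Σᵢ μᵢ`. -/
def psize (μ : ℕ → ℕ) : ℕ := ∑ᶠ i, μ i

/-- `Σᵢ C(μᵢ, 2)`. -/
def binom2Sum (μ : ℕ → ℕ) : ℕ := ∑ᶠ i, Nat.choose (μ i) 2

/-- The set `P` of infinite plane partitions with limit shape `μ` along the z-axis
(infinite columns exactly over the Young diagram of `μᵗ`), bounded finite entries,
stabilizing to `λᵗ` along the x-direction and to `ν` along the y-direction.
Everything is 0-indexed: the entry of the cell `(i+1, j+1)` is `π i j`. -/
def InfPP (lam mu nu : ℕ → ℕ) (π : ℕ → ℕ → ℕ∞) : Prop :=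
  (∀ i j, π i (j + 1) ≤ π i j) ∧ (∀ i j, π (i + 1) j ≤ π i j) ∧
  (∀ i j, π i j = ⊤ ↔ j < conj mu i) ∧
  (∃ B : ℕ, ∀ i j, π i j ≠ ⊤ → π i j ≤ (B : ℕ∞)) ∧
  (∃ I, ∀ i, I ≤ i → ∀ j, π i j = (conj lam j : ℕ∞)) ∧
  (∃ J, ∀ j, J ≤ j → ∀ i, π i j = (nu i : ℕ∞))

/-- Diagonal truncated size: `t_K(π) = Σ_{|i−j| ≤ K−1} min(π_{i,j}, K)` (1-indexed cells,
so the condition is `i < j + K ∧ j < i + K` on 0-indexed cells). -/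
def tK (π : ℕ → ℕ → ℕ∞) (K : ℕ) : ℕ :=
  ∑ᶠ p : ℕ × ℕ,
    if p.1 < p.2 + K ∧ p.2 < p.1 + K then (min (π p.1 p.2) (K : ℕ∞)).toNat else 0

/-- Box truncated size: `b_K(π) = Σ_{i ≤ K, j ≤ K} min(π_{i,j}, K)` (1-indexed cells). -/
def bK (π : ℕ → ℕ → ℕ∞) (K : ℕ) : ℕ :=
  ∑ i ∈ range K, ∑ j ∈ range K, (min (π i j) (K : ℕ∞)).toNat

lemma lt_conj {μ : ℕ → ℕ} (h : IsPartition μ) (i j : ℕ) : i < conj μ j ↔ j < μ i := by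
  obtain ⟨ha, n, hn⟩ := h
  have hex : ∃ m, μ m < j + 1 := ⟨n, by omega⟩
  have hs : {i | j + 1 ≤ μ i} = ((Finset.range (Nat.find hex) : Finset ℕ) : Set ℕ) := by
    ext k
    simp only [Set.mem_setOf_eq, Finset.coe_range, Set.mem_Iio]
    constructor
    · intro hk
      by_contra hc
      have h1 := Nat.find_spec hex
      have h2 := ha (not_lt.mp hc)
      omega
    · intro hk
      have := Nat.find_min hex hk
      omega
  have hc : conj μ j = Nat.find hex := by
    unfold conj
    rw [hs, Set.ncard_coe_finset, Finset.card_range]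
  have hm : i ∈ {i | j + 1 ≤ μ i} ↔ i < conj μ j := by
    rw [hs, hc]; simp
  rw [← hm]; simp [Nat.succ_le_iff]

lemma conj_isPartition {μ : ℕ → ℕ} (h : IsPartition μ) : IsPartition (conj μ) := by
  constructor
  · intro a b hab
    by_contra hc
    have h1 := (lt_conj h _ _).1 (not_le.mp hc)
    have h2 := (lt_conj h (conj μ a) a).2 (by omega)
    omega
  · refine ⟨μ 0, ?_⟩
    by_contra hc
    have := (lt_conj h 0 (μ 0)).1 (by omega)
    omega

lemma conj_conj {μ : ℕ → ℕ} (h : IsPartition μ) : conj (conj μ) = μ := by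
  funext j
  have : ∀ i, i < conj (conj μ) j ↔ i < μ j := fun i => by
    rw [lt_conj (conj_isPartition h), lt_conj h]
  have h1 := this (μ j)
  have h2 := this (conj (conj μ) j)
  omega

lemma IsPartition.eventually {μ : ℕ → ℕ} (h : IsPartition μ) :
    ∃ n, ∀ i, n ≤ i → μ i = 0 := by
  obtain ⟨ha, n, hn⟩ := h
  exact ⟨n, fun i hi => by have := ha hi; omega⟩

lemma finsum_range (f : ℕ → ℕ) (K : ℕ) (h : ∀ i, K ≤ i → f i = 0) :
    ∑ᶠ i, f i = ∑ i ∈ range K, f i := by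
  apply finsum_eq_sum_of_support_subset
  intro i hi
  by_contra hc
  simp only [Finset.coe_range, Set.mem_Iio, not_lt] at hc
  exact hi (h i hc)

lemma sum_ite_lt (c : ℕ → ℕ) (m K : ℕ) (h : m ≤ K) :
    ∑ j ∈ range K, (if j < m then c j else 0) = ∑ j ∈ range m, c j := by
  rw [← Finset.sum_filter]
  congr 1
  ext j; simp; omega

lemma double_count {μ : ℕ → ℕ} (h : IsPartition μ) (f : ℕ → ℕ) (K : ℕ)
    (h1 : ∀ i, μ i ≤ K) (h2 : ∀ j, conj μ j ≤ K) :
    ∑ i ∈ range K, f i * μ i = ∑ j ∈ range K, ∑ i ∈ range (conj μ j), f i := by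
  have e1 : ∀ i, f i * μ i = ∑ j ∈ range K, (if j < μ i then f i else 0) := fun i => by
    rw [sum_ite_lt (fun _ => f i) _ _ (h1 i)]; simp [mul_comm]
  simp only [e1]
  rw [Finset.sum_comm]
  refine Finset.sum_congr rfl fun j _ => ?_
  rw [← sum_ite_lt f _ _ (h2 j)]
  simp only [lt_conj h]

lemma IsPartition.le_zero {μ : ℕ → ℕ} (h : IsPartition μ) (i : ℕ) : μ i ≤ μ 0 :=
  h.1 (Nat.zero_le i)

lemma zero_of_ge {μ : ℕ → ℕ} (h : IsPartition μ) {i : ℕ} (hi : conj μ 0 ≤ i) : μ i = 0 := by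
  have := lt_conj h i 0
  omega

lemma psize_conj {μ : ℕ → ℕ} (h : IsPartition μ) (K : ℕ) (h1 : μ 0 ≤ K) (h2 : conj μ 0 ≤ K) :
    ∑ j ∈ range K, conj μ j = psize μ := by
  have := double_count h (fun _ => 1) K (fun i => (h.le_zero i).trans h1)
    (fun j => ((conj_isPartition h).le_zero j).trans h2)
  unfold psize
  rw [finsum_range μ K (fun i hi => zero_of_ge h (h2.trans hi))]
  simpa using this.symm

lemma psize_eq {μ : ℕ → ℕ} (h : IsPartition μ) (K : ℕ) (h2 : conj μ 0 ≤ K) :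
    ∑ j ∈ range K, μ j = psize μ := by
  unfold psize
  rw [finsum_range μ K (fun i hi => zero_of_ge h (h2.trans hi))]

lemma binom_conj {μ : ℕ → ℕ} (h : IsPartition μ) (K : ℕ) (h1 : μ 0 ≤ K) (h2 : conj μ 0 ≤ K) :
    ∑ i ∈ range K, i * μ i = binom2Sum (conj μ) := by
  have := double_count h (fun i => i) K (fun i => (h.le_zero i).trans h1)
    (fun j => ((conj_isPartition h).le_zero j).trans h2)
  unfold binom2Sum
  rw [finsum_range _ K (fun i hi => ?_), this]
  · refine Finset.sum_congr rfl fun j _ => ?_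
    rw [Finset.sum_range_id, Nat.choose_two_right]
  · rw [zero_of_ge (conj_isPartition h) (by rw [conj_conj h]; omega)]; rfl

lemma binom_lam {μ : ℕ → ℕ} (h : IsPartition μ) (K : ℕ) (h1 : μ 0 ≤ K) (h2 : conj μ 0 ≤ K) :
    ∑ i ∈ range K, i * conj μ i = binom2Sum μ := by
  have := binom_conj (conj_isPartition h) K h2 (by rw [conj_conj h]; exact h1)
  rwa [conj_conj h] at this

/-- All the facts valid beyond a threshold. -/
def Good (lam mu nu : ℕ → ℕ) (π : ℕ → ℕ → ℕ∞) (K : ℕ) : Prop :=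
  (∀ i, K ≤ i → ∀ j, π i j = (conj lam j : ℕ∞)) ∧
  (∀ j, K ≤ j → ∀ i, π i j = (nu i : ℕ∞)) ∧
  (∀ i j, π i j ≠ ⊤ → π i j ≤ (K : ℕ∞)) ∧
  lam 0 ≤ K ∧ conj lam 0 ≤ K ∧ mu 0 ≤ K ∧ conj mu 0 ≤ K ∧ nu 0 ≤ K ∧ conj nu 0 ≤ K

lemma exists_good {lam mu nu : ℕ → ℕ} {π : ℕ → ℕ → ℕ∞} (h : InfPP lam mu nu π) :
    ∃ K₀, ∀ K, K₀ ≤ K → Good lam mu nu π K := by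
  obtain ⟨-, -, -, ⟨B, hB⟩, ⟨I, hI⟩, ⟨J, hJ⟩⟩ := h
  refine ⟨I + J + B + lam 0 + conj lam 0 + mu 0 + conj mu 0 + nu 0 + conj nu 0, fun K hK => ?_⟩
  refine ⟨fun i hi => hI i (by omega), fun j hj => hJ j (by omega), fun i j hij => ?_,
    by omega, by omega, by omega, by omega, by omega, by omega⟩
  refine (hB i j hij).trans ?_
  exact_mod_cast (by omega : B ≤ K)

lemma min_nat (a K : ℕ) (h : a ≤ K) : (min (a : ℕ∞) (K : ℕ∞)).toNat = a := by
  rw [min_eq_left (by exact_mod_cast h)]; rfl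

lemma Good.corner {lam mu nu : ℕ → ℕ} (hn : IsPartition nu) {π : ℕ → ℕ → ℕ∞} {K : ℕ}
    (g : Good lam mu nu π K) {i j : ℕ} (hi : K ≤ i) (hj : K ≤ j) : π i j = 0 := by
  rw [g.2.1 j hj i, zero_of_ge hn (g.2.2.2.2.2.2.2.2.trans hi)]; rfl

lemma t_eq {lam mu nu : ℕ → ℕ} (hl : IsPartition lam) (hn : IsPartition nu)
    {π : ℕ → ℕ → ℕ∞} {K : ℕ} (g : Good lam mu nu π K) :
    tK π K = bK π K + (binom2Sum lam + binom2Sum (conj nu)) := by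
  have g' := g
  obtain ⟨g1, g2, g3, g4, g5, g6, g7, g8, g9⟩ := g'
  unfold tK
  rw [finsum_eq_sum_of_support_subset (s := range (K + K) ×ˢ range (K + K))]
  · rw [Finset.sum_product, Finset.sum_range_add]
    simp only [Finset.sum_range_add, Finset.sum_add_distrib]
    have A : ∑ x ∈ range K, ∑ y ∈ range K,
        (if x < y + K ∧ y < x + K then (min (π x y) (K : ℕ∞)).toNat else 0) = bK π K := by
      refine Finset.sum_congr rfl fun x hx => Finset.sum_congr rfl fun y hy => ?_
      rw [Finset.mem_range] at hx hy
      rw [if_pos (by omega)]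
    have B : ∑ x ∈ range K, ∑ y ∈ range K,
        (if x < K + y + K ∧ K + y < x + K then (min (π x (K + y)) (K : ℕ∞)).toNat else 0)
          = binom2Sum (conj nu) := by
      rw [← binom_conj hn K g8 g9]
      refine Finset.sum_congr rfl fun x hx => ?_
      rw [Finset.mem_range] at hx
      have : ∑ y ∈ range K, (if y < x then nu x else 0) = x * nu x := by
        rw [sum_ite_lt (fun _ => nu x) _ _ hx.le]; simp
      rw [← this]
      refine Finset.sum_congr rfl fun y hy => ?_
      rw [g2 (K + y) (by omega), min_nat _ _ ((hn.le_zero x).trans g8)]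
      exact if_congr (by omega) rfl rfl
    have C : ∑ x ∈ range K, ∑ y ∈ range K,
        (if K + x < y + K ∧ y < K + x + K then (min (π (K + x) y) (K : ℕ∞)).toNat else 0)
          = binom2Sum lam := by
      rw [← binom_lam hl K g4 g5, Finset.sum_comm]
      refine Finset.sum_congr rfl fun x hx => ?_
      rw [Finset.mem_range] at hx
      have : ∑ y ∈ range K, (if y < x then conj lam x else 0) = x * conj lam x := by
        rw [sum_ite_lt (fun _ => conj lam x) _ _ hx.le]; simp
      rw [← this]
      refine Finset.sum_congr rfl fun y hy => ?_
      rw [g1 (K + y) (by omega), min_nat _ _ (((conj_isPartition hl).le_zero x).trans g5)]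
      exact if_congr (by omega) rfl rfl
    have D : ∑ x ∈ range K, ∑ y ∈ range K,
        (if K + x < K + y + K ∧ K + y < K + x + K then
          (min (π (K + x) (K + y)) (K : ℕ∞)).toNat else 0) = 0 := by
      refine Finset.sum_eq_zero fun x _ => Finset.sum_eq_zero fun y _ => ?_
      rw [g.corner hn (by omega) (by omega)]; simp
    rw [A, B, C, D]; omega
  · rintro ⟨i, j⟩ hij
    by_contra hc
    apply hij
    simp only [Finset.coe_product, Finset.coe_range, Set.mem_prod, Set.mem_Iio] at hc
    show (if i < j + K ∧ j < i + K then (min (π i j) (K : ℕ∞)).toNat else 0) = 0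
    split_ifs with h
    · rw [g.corner hn (by omega) (by omega)]; simp
    · rfl

lemma b_succ {lam mu nu : ℕ → ℕ} (hl : IsPartition lam) (hm : IsPartition mu)
    (hn : IsPartition nu) {π : ℕ → ℕ → ℕ∞} (hp : InfPP lam mu nu π) {K : ℕ}
    (g : Good lam mu nu π K) :
    bK π (K + 1) = bK π K + (psize lam + psize mu + psize nu) := by
  have g' := g
  obtain ⟨g1, g2, g3, g4, g5, g6, g7, g8, g9⟩ := g'
  unfold bK
  rw [Finset.sum_range_succ]
  simp only [Finset.sum_range_succ, Finset.sum_add_distrib]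
  have A : ∑ x ∈ range K, ∑ y ∈ range K, (min (π x y) ((K + 1 : ℕ) : ℕ∞)).toNat
      = (∑ x ∈ range K, ∑ y ∈ range K, (min (π x y) (K : ℕ∞)).toNat) + psize mu := by
    rw [← psize_conj hm K g6 g7, ← Finset.sum_add_distrib]
    refine Finset.sum_congr rfl fun x _ => ?_
    have : ∑ y ∈ range K, (if y < conj mu x then 1 else 0) = conj mu x := by
      rw [sum_ite_lt (fun _ => 1) _ _ (((conj_isPartition hm).le_zero x).trans g7)]; simp
    rw [← this, ← Finset.sum_add_distrib]
    refine Finset.sum_congr rfl fun y _ => ?_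
    by_cases h : π x y = ⊤
    · rw [if_pos ((hp.2.2.1 x y).1 h), h, min_eq_right le_top, min_eq_right le_top]; rfl
    · rw [if_neg (fun hc => h ((hp.2.2.1 x y).2 hc))]
      have h3 := g3 x y h
      rw [min_eq_left h3, min_eq_left (h3.trans (by exact_mod_cast Nat.le_succ K))]
      rfl
  have B : ∑ x ∈ range K, (min (π x K) ((K + 1 : ℕ) : ℕ∞)).toNat = psize nu := by
    rw [← psize_eq hn K g9]
    refine Finset.sum_congr rfl fun x _ => ?_
    rw [g2 K le_rfl, min_nat _ _ (((hn.le_zero x).trans g8).trans (Nat.le_succ K))]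
  have C : ∑ x ∈ range K, (min (π K x) ((K + 1 : ℕ) : ℕ∞)).toNat = psize lam := by
    rw [← psize_conj hl K g4 g5]
    refine Finset.sum_congr rfl fun x _ => ?_
    rw [g1 K le_rfl, min_nat _ _ ((((conj_isPartition hl).le_zero x).trans g5).trans
      (Nat.le_succ K))]
  have D : (min (π K K) ((K + 1 : ℕ) : ℕ∞)).toNat = 0 := by
    rw [g.corner hn le_rfl le_rfl]; simp
  rw [A, B, C, D]; omega

/-- for every `π ∈ P` and sufficiently large `K`,
`t_K(π) − b_K(π) = Σᵢ C(λᵢ,2) + Σᵢ C(νᵗᵢ,2)`; the modified sizes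
`t_K(π) − K(|λ|+|μ|+|ν|)` and `b_K(π) − K(|λ|+|μ|+|ν|)` are independent of sufficiently
large `K`; and `q^{−ΣC(λᵢ,2)−ΣC(νᵗᵢ,2)} · Σ_π q^{t-modified size} = Σ_π q^{b-modified size}`
in `ℤ[[q]][q^{−1}]`, stated coefficientwise. -/
theorem stmt3 (lam mu nu : ℕ → ℕ)
    (hl : IsPartition lam) (hm : IsPartition mu) (hn : IsPartition nu) :
    (∀ π, InfPP lam mu nu π → ∃ K₀, ∀ K, K₀ ≤ K →
        tK π K = bK π K + (binom2Sum lam + binom2Sum (conj nu))) ∧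
    (∀ π, InfPP lam mu nu π → ∃ K₀, ∀ K K', K₀ ≤ K → K₀ ≤ K' →
        ((tK π K : ℤ) - (K : ℤ) * ((psize lam + psize mu + psize nu : ℕ) : ℤ)
            = (tK π K' : ℤ) - (K' : ℤ) * ((psize lam + psize mu + psize nu : ℕ) : ℤ)) ∧
        ((bK π K : ℤ) - (K : ℤ) * ((psize lam + psize mu + psize nu : ℕ) : ℤ)
            = (bK π K' : ℤ) - (K' : ℤ) * ((psize lam + psize mu + psize nu : ℕ) : ℤ))) ∧
    (∀ m : ℤ,
      Nat.card {π : ℕ → ℕ → ℕ∞ // InfPP lam mu nu π ∧ ∃ K₀, ∀ K, K₀ ≤ K →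
          (tK π K : ℤ) - (K : ℤ) * ((psize lam + psize mu + psize nu : ℕ) : ℤ)
            = m + ((binom2Sum lam + binom2Sum (conj nu) : ℕ) : ℤ)}
        = Nat.card {π : ℕ → ℕ → ℕ∞ // InfPP lam mu nu π ∧ ∃ K₀, ∀ K, K₀ ≤ K →
            (bK π K : ℤ) - (K : ℤ) * ((psize lam + psize mu + psize nu : ℕ) : ℤ) = m}) := by
  have P1 : ∀ π, InfPP lam mu nu π → ∃ K₀, ∀ K, K₀ ≤ K →
        tK π K = bK π K + (binom2Sum lam + binom2Sum (conj nu)) := fun π hp => by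
    obtain ⟨K₀, h⟩ := exists_good hp
    exact ⟨K₀, fun K hK => t_eq hl hn (h K hK)⟩
  refine ⟨P1, fun π hp => ?_, fun m => ?_⟩
  · obtain ⟨K₀, h⟩ := exists_good hp
    have hb : ∀ K, K₀ ≤ K →
        (bK π K : ℤ) - (K : ℤ) * ((psize lam + psize mu + psize nu : ℕ) : ℤ)
        = (bK π K₀ : ℤ) - (K₀ : ℤ) * ((psize lam + psize mu + psize nu : ℕ) : ℤ) := by
      intro K hK
      induction K, hK using Nat.le_induction with
      | base => rfl
      | succ K hK ih =>
        rw [← ih, b_succ hl hm hn hp (h K hK)]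
        push_cast; ring
    refine ⟨K₀, fun K K' hK hK' => ?_⟩
    have e1 := hb K hK
    have e2 := hb K' hK'
    refine ⟨?_, by rw [e1, e2]⟩
    rw [t_eq hl hn (h K hK), t_eq hl hn (h K' hK')]
    push_cast at *
    linarith
  · refine Nat.card_congr (Equiv.subtypeEquivRight fun π => and_congr_right fun hp => ?_)
    obtain ⟨K₁, h1⟩ := P1 π hp
    constructor
    · rintro ⟨K₀, h⟩
      refine ⟨K₀ + K₁, fun K hK => ?_⟩
      have a := h K (by omega)
      rw [h1 K (by omega)] at a
      push_cast at *
      linarith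
    · rintro ⟨K₀, h⟩
      refine ⟨K₀ + K₁, fun K hK => ?_⟩
      have a := h K (by omega)
      rw [h1 K (by omega)]
      push_cast at *
      linarith

end
end

section
/- Let μ be a partition with Frobenius notation (m₁,…,m_r | n₁,…,n_r), r ≥ 1, and hook lengths h(i,j) = μᵢ + μᵗ_j − i − j + 1. Then: (i) h(1,i) = m₁ + nᵢ + 1 for 1 ≤ i ≤ r; (ii) {h(1,i) : r < i ≤ μ₁} = {1, 2, …, m₁} ∖ {m₁ − m₂, m₁ − m₃, …, m₁ − m_r} as sets; (iii) h(i,1) = n₁ + mᵢ + 1 for 1 ≤ i ≤ r; (iv) {h(i,1) : r < i ≤ μᵗ₁} = {1, 2, …, n₁} ∖ {n₁ − n₂, n₁ − n₃, …, n₁ − n_r} as sets. -/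
open Finset PowerSeries

noncomputable section

/-- The Frobenius length `r = #{i : μᵢ ≥ i}` of a partition (0-indexed: diagonal cells
`(i,i)` with `i < μ i`). -/
def frobLen (μ : ℕ → ℕ) : ℕ := Set.ncard {i | i < μ i}

theorem aux_init {S : Set ℕ} (hS : ∀ i j, i ≤ j → j ∈ S → i ∈ S) {n : ℕ} (hn : n ∉ S) (i : ℕ) :
    i ∈ S ↔ i < S.ncard := by
  classical
  have hex : ∃ n, n ∉ S := ⟨n, hn⟩
  have hE : S = (Finset.range (Nat.find hex) : Set ℕ) := by
    ext k
    simp only [Finset.coe_range, Set.mem_Iio]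
    constructor
    · intro hk
      by_contra hlt
      exact Nat.find_spec hex (hS _ k (not_lt.mp hlt) hk)
    · intro hk
      by_contra hkS
      exact Nat.find_min hex hk hkS
  rw [hE, Set.ncard_coe_finset]
  simp

theorem aux_galois {μ : ℕ → ℕ} (hμ : IsPartition μ) (i j : ℕ) : j < μ i ↔ i < conj μ j := by
  obtain ⟨ha, n, hn⟩ := hμ
  refine aux_init (S := {i | j + 1 ≤ μ i}) ?_ (n := n) ?_ i
  · intro i k hik hk
    exact le_trans hk (ha hik)
  · simp [hn]

theorem aux_frob {μ : ℕ → ℕ} (hμ : IsPartition μ) (i : ℕ) : i < frobLen μ ↔ i < μ i := by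
  obtain ⟨ha, n, hn⟩ := hμ
  refine (aux_init (S := {i | i < μ i}) ?_ (n := n) ?_ i).symm
  · intro i k hik hk
    have h1 := ha hik
    simp only [Set.mem_setOf_eq] at *
    omega
  · simp [hn]

theorem aux_main (a b : ℕ → ℕ) (r : ℕ) (hab : ∀ i j, j < a i ↔ i < b j)
    (hra : ∀ i, i < r ↔ i < a i) (hr : 1 ≤ r) :
    Finset.image (fun j => a 0 + b j - (0 + j + 1)) (Finset.Ico r (a 0))
      = Finset.Icc 1 (a 0 - 1) \
          Finset.image (fun i => (a 0 - 1) - (a i - (i + 1))) (Finset.Ico 1 r) := by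
  have hanti : ∀ i, a i ≤ a 0 := by
    intro i
    by_contra h
    have h1 := hab i (a 0)
    have h2 := hab 0 (a 0)
    omega
  ext x
  simp only [Finset.mem_image, Finset.mem_Ico, Finset.mem_sdiff, Finset.mem_Icc]
  constructor
  · rintro ⟨j, ⟨hj1, hj2⟩, rfl⟩
    have h1 := hab 0 j
    have h2 := hab j j
    have h3 := hra j
    refine ⟨by omega, ?_⟩
    rintro ⟨i, ⟨hi1, hi2⟩, he⟩
    have h4 := hab i j
    have h5 := hra i
    have h6 := hanti i
    omega
  · rintro ⟨⟨hx1, hx2⟩, hx⟩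
    have hex : ∃ j, a 0 + b j ≤ x + j + 1 := by
      refine ⟨a 0, ?_⟩
      have := hab 0 (a 0)
      omega
    classical
    obtain ⟨j, hj, hmin⟩ : ∃ j, a 0 + b j ≤ x + j + 1 ∧ ∀ k < j, ¬ (a 0 + b k ≤ x + k + 1) :=
      ⟨Nat.find hex, Nat.find_spec hex, fun k hk => Nat.find_min hex hk⟩
    have h1 := hab j j
    have h2 := hra j
    have h3 := hab 0 j
    have h00 := hab 0 0
    have hr0 := hra 0
    by_cases heq : a 0 + b j = x + j + 1
    · exact ⟨j, by omega, by omega⟩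
    · exfalso
      have hj0 : 1 ≤ j := by
        rcases Nat.eq_zero_or_pos j with h | h
        · subst h
          omega
        · exact h
      have h4 := hmin (j - 1) (by omega)
      obtain ⟨i, hi⟩ : ∃ i, i + a 0 = x + j := ⟨x + j - a 0, by omega⟩
      have h5 := hab i j
      have h6 := hab i (j - 1)
      have h7 := hra i
      have hai : a i = j := by omega
      have h8 : i ≠ 0 := by
        rintro rfl
        omega
      have h9 := hanti i
      exact hx ⟨i, by omega, by omega⟩

/-- for a partition `μ = (m₁,…,m_r | n₁,…,n_r)` in Frobenius notation with
`r ≥ 1` (so `mᵢ = μᵢ − i`, `nⱼ = μᵗⱼ − j`, 1-indexed):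
(i) `h(1,i) = m₁ + nᵢ + 1` for `1 ≤ i ≤ r`;
(ii) `{h(1,i) : r < i ≤ μ₁} = {1,…,m₁} ∖ {m₁−m₂,…,m₁−m_r}`;
(iii) `h(i,1) = n₁ + mᵢ + 1` for `1 ≤ i ≤ r`;
(iv) `{h(i,1) : r < i ≤ μᵗ₁} = {1,…,n₁} ∖ {n₁−n₂,…,n₁−n_r}`. -/
theorem stmt13 (μ : ℕ → ℕ) (hμ : IsPartition μ) (hr : 1 ≤ frobLen μ) :
    (∀ i < frobLen μ, hook μ (0, i) = (μ 0 - 1) + (conj μ i - (i + 1)) + 1) ∧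
    (Finset.image (fun j => hook μ (0, j)) (Finset.Ico (frobLen μ) (μ 0))
      = Finset.Icc 1 (μ 0 - 1) \
          Finset.image (fun i => (μ 0 - 1) - (μ i - (i + 1))) (Finset.Ico 1 (frobLen μ))) ∧
    (∀ i < frobLen μ, hook μ (i, 0) = (conj μ 0 - 1) + (μ i - (i + 1)) + 1) ∧
    (Finset.image (fun i => hook μ (i, 0)) (Finset.Ico (frobLen μ) (conj μ 0))
      = Finset.Icc 1 (conj μ 0 - 1) \
          Finset.image (fun i => (conj μ 0 - 1) - (conj μ i - (i + 1)))
            (Finset.Ico 1 (frobLen μ))) := by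
  have hg := aux_galois hμ
  have hf := aux_frob hμ
  have hf' : ∀ i, i < frobLen μ ↔ i < conj μ i := fun i => (hf i).trans (hg i i)
  have h0 := hf 0
  have h0' := hf' 0
  refine ⟨?_, aux_main μ (conj μ) _ hg hf hr, ?_, ?_⟩
  · intro i hi
    have h1 := hf' i
    simp only [hook]
    omega
  · intro i hi
    have h1 := hf i
    simp only [hook]
    omega
  · rw [← aux_main (conj μ) μ _ (fun i j => (hg j i).symm) hf' hr]
    refine Finset.image_congr ?_
    intro i _
    simp only [hook]
    omega

end
end

section
/- The map sending a finite plane partition π to its sequence of diagonal slices (μᵏ)_{k∈ℤ}, where μᵏ_i = π_{i, k+i} for k ≥ 0 and μᵏ_i = π_{i−k, i} for k < 0, is a bijection between the set of finite plane partitions and the set of sequences (μᵏ)_{k∈ℤ} of partitions, all but finitely many empty, satisfying the interlacing conditions μ^{k−1} ≺ μ^{k} for all k ≤ 0 and μ^{k} ≻ μ^{k+1} for all k ≥ 0. Moreover, under this bijection |π| = Σ_{k∈ℤ} |μᵏ|. -/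
open Finset PowerSeries

noncomputable section

/-- `μ` interlaces `λ`, written `μ ≻ λ`: `μ_j ≥ λ_j ≥ μ_{j+1}` for all `j ≥ 1`
(0-indexed parts). -/
def Interlaces (μ lam : ℕ → ℕ) : Prop := ∀ j, lam j ≤ μ j ∧ μ (j + 1) ≤ lam j

/-- A finite plane partition: 0-indexed entries `π i j` (for the cell `(i+1, j+1)`),
weakly decreasing in each argument, with finite size (equivalently, finitely many nonzero
entries). -/
def IsFinitePP (π : ℕ → ℕ → ℕ) : Prop :=
  (∀ i j, π i (j + 1) ≤ π i j) ∧ (∀ i j, π (i + 1) j ≤ π i j) ∧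
  {p : ℕ × ℕ | π p.1 p.2 ≠ 0}.Finite

/-- The `k`-th diagonal diagSlice of a plane partition: `μᵏ_i = π_{i, k+i}` for `k ≥ 0` and
`μᵏ_i = π_{i−k, i}` for `k < 0` (0-indexed parts and entries). -/
def diagSlice (π : ℕ → ℕ → ℕ) (k : ℤ) : ℕ → ℕ :=
  fun i => if 0 ≤ k then π i (i + k.toNat) else π (i + (-k).toNat) i

/-- Sequences of partitions `(μᵏ)_{k∈ℤ}`, all but finitely many empty, satisfying the
interlacing conditions `μ^{k−1} ≺ μ^k` for `k ≤ 0` and `μ^k ≻ μ^{k+1}` for `k ≥ 0`. -/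
def GoodSeq (s : ℤ → ℕ → ℕ) : Prop :=
  (∀ k, IsPartition (s k)) ∧ {k | s k ≠ fun _ => 0}.Finite ∧
  (∀ k : ℤ, k ≤ 0 → Interlaces (s k) (s (k - 1))) ∧
  (∀ k : ℤ, 0 ≤ k → Interlaces (s k) (s (k + 1)))

def diagEquiv : ℤ × ℕ ≃ ℕ × ℕ where
  toFun q := (q.2 + (-q.1).toNat, q.2 + q.1.toNat)
  invFun p := ((p.2 : ℤ) - p.1, min p.1 p.2)
  left_inv q := by
    rcases q with ⟨k, i⟩
    apply Prod.ext <;> simp only <;> omega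
  right_inv p := by
    rcases p with ⟨a, b⟩
    apply Prod.ext <;> simp only <;> omega

theorem diagSlice_eq (π : ℕ → ℕ → ℕ) (k : ℤ) (i : ℕ) :
    diagSlice π k i = π (i + (-k).toNat) (i + k.toNat) := by
  unfold diagSlice
  split_ifs with h
  · have : (-k).toNat = 0 := by omega
    rw [this, Nat.add_zero]
  · have : k.toNat = 0 := by omega
    rw [this, Nat.add_zero]

theorem diagSlice_supp (π : ℕ → ℕ → ℕ) (h : {p : ℕ × ℕ | π p.1 p.2 ≠ 0}.Finite) :
    {q : ℤ × ℕ | diagSlice π q.1 q.2 ≠ 0}.Finite := by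
  refine (h.preimage (f := diagEquiv) diagEquiv.injective.injOn).subset ?_
  rintro ⟨k, i⟩ hq
  simp only [Set.mem_setOf_eq, diagSlice_eq] at hq
  exact hq

theorem diagSlice_good (π : ℕ → ℕ → ℕ) (h : IsFinitePP π) : GoodSeq (diagSlice π) := by
  have hS := diagSlice_supp π h.2.2
  obtain ⟨h1, h2, -⟩ := h
  refine ⟨fun k => ⟨antitone_nat_of_succ_le fun n => ?_, ?_⟩, ?_, ?_, ?_⟩
  · rw [diagSlice_eq, diagSlice_eq, Nat.add_right_comm n 1, Nat.add_right_comm n 1]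
    exact (h1 _ _).trans (h2 _ _)
  · by_contra hn
    push Not at hn
    have hinj : Function.Injective (fun n : ℕ => (k, n)) := fun a b hab => (Prod.ext_iff.1 hab).2
    exact Set.infinite_range_of_injective hinj
      (hS.subset (by rintro _ ⟨n, rfl⟩; exact hn n))
  · refine (hS.image Prod.fst).subset ?_
    intro k hk
    obtain ⟨i, hi⟩ := Function.ne_iff.1 hk
    exact ⟨(k, i), hi, rfl⟩
  · intro k hk j
    simp only [diagSlice_eq]
    have e1 : k.toNat = 0 := by omega
    have e2 : (k - 1).toNat = 0 := by omega
    have e3 : (-(k - 1)).toNat = (-k).toNat + 1 := by omega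
    rw [e1, e2, e3]
    refine ⟨h2 _ _, ?_⟩
    have := h1 (j + ((-k).toNat + 1)) j
    rwa [show j + 1 + (-k).toNat = j + ((-k).toNat + 1) by omega]
  · intro k hk j
    simp only [diagSlice_eq]
    have e1 : (-k).toNat = 0 := by omega
    have e2 : (-(k + 1)).toNat = 0 := by omega
    have e3 : (k + 1).toNat = k.toNat + 1 := by omega
    rw [e1, e2, e3]
    refine ⟨h1 _ _, ?_⟩
    have := h2 j (j + (k.toNat + 1))
    rwa [show j + 1 + k.toNat = j + (k.toNat + 1) by omega]

def undiag (s : ℤ → ℕ → ℕ) (a b : ℕ) : ℕ := s ((b : ℤ) - a) (min a b)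

theorem diagSlice_undiag (s : ℤ → ℕ → ℕ) : diagSlice (undiag s) = s := by
  funext k i
  rw [diagSlice_eq]
  unfold undiag
  congr 1
  · congr 1; omega
  · omega

theorem undiag_diagSlice (π : ℕ → ℕ → ℕ) : undiag (diagSlice π) = π := by
  funext a b
  unfold undiag
  rw [diagSlice_eq]
  congr 1
  · congr 1; omega
  · omega

theorem undiag_pp (s : ℤ → ℕ → ℕ) (h : GoodSeq s) : IsFinitePP (undiag s) := by
  obtain ⟨hp, hf, hneg, hpos⟩ := h
  refine ⟨fun i j => ?_, fun i j => ?_, ?_⟩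
  · unfold undiag
    rcases le_or_gt i j with hij | hij
    · have := (hpos ((j : ℤ) - i) (by omega) i).1
      rw [min_eq_left hij, min_eq_left (by omega : i ≤ j + 1)]
      convert this using 2
      push_cast; ring
    · have := (hneg (((j + 1 : ℕ) : ℤ) - i) (by omega) j).2
      rw [min_eq_right hij.le, min_eq_right (by omega : j + 1 ≤ i)]
      convert this using 2
      push_cast; ring
  · unfold undiag
    rcases le_or_gt j i with hij | hij
    · have := (hneg ((j : ℤ) - i) (by omega) j).1
      rw [min_eq_right hij, min_eq_right (by omega : j ≤ i + 1)]
      convert this using 2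
      push_cast; ring
    · have := (hpos ((j : ℤ) - (i + 1 : ℕ)) (by omega) i).2
      rw [min_eq_left hij.le, min_eq_left (by omega : i + 1 ≤ j)]
      convert this using 2
      push_cast; ring
  · have hS : {q : ℤ × ℕ | s q.1 q.2 ≠ 0}.Finite := by
      choose n hn using fun k => (hp k).2
      refine (hf.biUnion (t := fun k => (fun i : ℕ => (k, i)) '' Set.Iio (n k))
        fun k _ => (Set.finite_Iio (n k)).image _).subset ?_
      rintro ⟨k, i⟩ hq
      simp only [Set.mem_setOf_eq] at hq
      refine Set.mem_biUnion (x := k) ?_ ⟨i, ?_, rfl⟩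
      · intro h0
        exact hq (congrFun h0 i)
      · by_contra hc
        have := (hp k).1 (not_lt.1 hc)
        rw [hn k] at this
        omega
    exact (hS.preimage (f := diagEquiv.symm) diagEquiv.symm.injective.injOn)

/-- taking diagonal slices is a bijection between finite plane partitions and
interlacing sequences of partitions with all but finitely many empty; moreover the size of
`π` equals `Σ_{k∈ℤ} |μᵏ|`. -/
theorem stmt15 :
    Set.BijOn (fun π : ℕ → ℕ → ℕ => diagSlice π) {π | IsFinitePP π} {s | GoodSeq s} ∧
    ∀ π : ℕ → ℕ → ℕ, IsFinitePP π →
      (∑ᶠ p : ℕ × ℕ, π p.1 p.2) = ∑ᶠ (k : ℤ) (i : ℕ), diagSlice π k i := by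
  refine ⟨⟨fun π h => diagSlice_good π h, ?_, ?_⟩, ?_⟩
  · intro a _ b _ hab
    have hab' : diagSlice a = diagSlice b := hab
    rw [← undiag_diagSlice a, hab', undiag_diagSlice]
  · intro s hs
    exact ⟨undiag s, undiag_pp s hs, diagSlice_undiag s⟩
  · intro π h
    have hc := finsum_curry (fun q : ℤ × ℕ => diagSlice π q.1 q.2) (diagSlice_supp π h.2.2)
    rw [← hc, ← finsum_comp_equiv diagEquiv]
    refine finsum_congr fun q => ?_
    rw [diagSlice_eq]
    rfl

end
end
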